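/- arXiv:2002.10285 — 10 statements merged into one kernel-verified Lean document; each statement's English description precedes it below -/
import Mathlib

section
/- For every n ≥ 1 the vertex action ▷ᵥ is a group action of G₊ on Gⁿ: 1 ▷ᵥ d = d and α ▷ᵥ (β ▷ᵥ d) = (α·β) ▷ᵥ d for all α, β ∈ G₊ and d ∈ Gⁿ. (The Lemma following Definition 3.5 of the paper, in the case of a vertex all of whose incident edges are incoming.) -/
/-- The partial vertex holonomy `cₖ(d) = π₋(d₁)⋯π₋(d_{k-1})` (ordered product over
the indices strictly below `k`). -/
def vertexPartial {G : Type*} [Group G] (πm : G → G) {n : ℕ}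
    (d : Fin n → G) (k : Fin n) : G :=
  (((List.finRange n).filter (fun i => decide (i < k))).map (fun i => πm (d i))).prod

/-- The vertex action `(α ▷ᵥ d)ₖ = π₊(α·cₖ(d))·dₖ` of `G₊` on `Gⁿ`,
for a vertex all of whose incident edges are incoming. -/
def vertexAct {G : Type*} [Group G] (πm πp : G → G) {n : ℕ}
    (α : G) (d : Fin n → G) : Fin n → G :=
  fun k => πp (α * vertexPartial πm d k) * d k

theorem List.filter_finRange_lt {n : ℕ} (k : Fin n) :
    (List.finRange n).filter (fun i => decide (i < k)) = (List.finRange n).take k := by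
  conv_lhs => rw [← List.take_append_drop k (List.finRange n)]
  rw [List.filter_append, List.filter_eq_self.2, List.filter_eq_nil_iff.2, List.append_nil]
  · intro a ha
    obtain ⟨i, hi, rfl⟩ := List.mem_iff_getElem.1 ha
    simp [Fin.le_def]
  · intro a ha
    obtain ⟨i, hi, rfl⟩ := List.mem_iff_getElem.1 ha
    simp only [List.length_take, lt_inf_iff] at hi
    simpa [Fin.lt_def] using hi.1

theorem vertexPartial_eq_prod_take {G : Type*} [Group G] (πm : G → G) {n : ℕ}
    (d : Fin n → G) (k : Fin n) :
    vertexPartial πm d k = (((List.finRange n).take k).map (fun i => πm (d i))).prod := by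
  rw [vertexPartial, List.filter_finRange_lt]

section Factorization

variable {G : Type*} [Group G] {Gm Gp : Subgroup G}
  (hc : Subgroup.IsComplement (Gm : Set G) (Gp : Set G)) {πm πp : G → G}
  (hπm : ∀ g, πm g ∈ Gm) (hπp : ∀ g, πp g ∈ Gp) (hfact : ∀ g, g = πm g * πp g)

include hc hπm hπp hfact

theorem factorization_proj_mul {a b : G} (ha : a ∈ Gm) (hb : b ∈ Gp) :
    πm (a * b) = a ∧ πp (a * b) = b := by
  have h := @hc.1 (⟨πm (a * b), hπm _⟩, ⟨πp (a * b), hπp _⟩) (⟨a, ha⟩, ⟨b, hb⟩)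
    (hfact (a * b)).symm
  simpa using h

theorem factorization_minus_mul (g x : G) : πm g * πm (πp g * x) = πm (g * x) := by
  have h := (factorization_proj_mul hc hπm hπp hfact
    (Gm.mul_mem (hπm g) (hπm (πp g * x))) (hπp (πp g * x))).1
  rw [mul_assoc, ← hfact (πp g * x), ← mul_assoc, ← hfact g] at h
  exact h.symm

theorem factorization_minus_mul_minus (g x : G) : πm (g * πm x) = πm (g * x) := by
  have h := (factorization_proj_mul hc hπm hπp hfact
    (hπm (g * πm x)) (Gp.mul_mem (hπp (g * πm x)) (hπp x))).1
  rw [← mul_assoc, ← hfact (g * πm x), mul_assoc, ← hfact x] at h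
  exact h.symm

theorem factorization_plus_mul (a g : G) :
    πp (a * πm g) * πp g = πp (a * g) := by
  have h := (factorization_proj_mul hc hπm hπp hfact
    (hπm (a * πm g)) (Gp.mul_mem (hπp (a * πm g)) (hπp g))).2
  rw [← mul_assoc, ← hfact (a * πm g), mul_assoc, ← hfact g] at h
  exact h.symm

theorem factorization_minus_of_mem {b : G} (hb : b ∈ Gp) : πm b = 1 := by
  simpa using (factorization_proj_mul hc hπm hπp hfact Gm.one_mem hb).1

theorem factorization_plus_of_mem {a : G} (ha : a ∈ Gm) : πp a = 1 := by
  simpa using (factorization_proj_mul hc hπm hπp hfact ha Gp.one_mem).2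

/-- The partial holonomies of `β ▷ᵥ d` are `cₖ(β ▷ᵥ d) = π₋(β·cₖ(d))`. -/
theorem vertexPartial_vertexAct {n : ℕ} (d : Fin n → G) {β : G} (hβ : β ∈ Gp) (k : Fin n) :
    vertexPartial πm (vertexAct πm πp β d) k = πm (β * vertexPartial πm d k) := by
  have key : ∀ m ≤ n,
      (((List.finRange n).take m).map (fun i => πm (vertexAct πm πp β d i))).prod =
        πm (β * (((List.finRange n).take m).map (fun i => πm (d i))).prod) := by
    intro m
    induction m with
    | zero => simp [factorization_minus_of_mem hc hπm hπp hfact hβ]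
    | succ m ih =>
      intro hm
      have hlen : m < (List.finRange n).length := by simpa using hm
      rw [← List.take_concat_get' _ _ hlen]
      rw [List.map_append, List.prod_append, ih (Nat.le_of_succ_le hm)]
      simp only [List.map_append, List.prod_append, List.map_cons, List.map_nil,
        List.prod_singleton, List.getElem_finRange, Fin.cast_mk, vertexAct,
        vertexPartial_eq_prod_take]
      rw [factorization_minus_mul hc hπm hπp hfact, ← mul_assoc,
        factorization_minus_mul_minus hc hπm hπp hfact]
  simpa only [vertexPartial_eq_prod_take] using key k k.isLt.le

end Factorization

/-- **The vertex action is a group action of `G₊` on `Gⁿ`:**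
`1 ▷ᵥ d = d` and `α ▷ᵥ (β ▷ᵥ d) = (α·β) ▷ᵥ d` for all `α, β ∈ G₊`, `d ∈ Gⁿ`. -/
theorem vertexAct_is_group_action {G : Type*} [Group G] (Gm Gp : Subgroup G)
    (hc : Subgroup.IsComplement (Gm : Set G) (Gp : Set G))
    (πm πp : G → G)
    (hπm : ∀ g, πm g ∈ Gm) (hπp : ∀ g, πp g ∈ Gp)
    (hfact : ∀ g, g = πm g * πp g) :
    ∀ n : ℕ, 1 ≤ n → ∀ d : Fin n → G,
      vertexAct πm πp (1 : G) d = d ∧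
      ∀ α β : G, α ∈ Gp → β ∈ Gp →
        vertexAct πm πp α (vertexAct πm πp β d) = vertexAct πm πp (α * β) d := by
  intro n _ d
  refine ⟨funext fun k => ?_, fun α β hα hβ => funext fun k => ?_⟩
  · have hmem : vertexPartial πm d k ∈ Gm := by
      refine Gm.list_prod_mem fun x hx => ?_
      obtain ⟨i, -, rfl⟩ := List.mem_map.1 hx
      exact hπm _
    simp [vertexAct, factorization_plus_of_mem hc hπm hπp hfact hmem]
  · change πp (α * vertexPartial πm (vertexAct πm πp β d) k) *
      (πp (β * vertexPartial πm d k) * d k) = πp (α * β * vertexPartial πm d k) * d k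
    rw [vertexPartial_vertexAct hc hπm hπp hfact d hβ, ← mul_assoc,
      factorization_plus_mul hc hπm hπp hfact, mul_assoc α]
end

section
/- The vertex holonomy intertwines the vertex action with the dressing action of G₊ on G₋: for all n ≥ 1, α ∈ G₊ and d ∈ Gⁿ one has Holᵥ(α ▷ᵥ d) = π₋(α·Holᵥ(d)), i.e. π₋(π₊(α·c₁(d))·d₁)·π₋(π₊(α·c₂(d))·d₂)⋯π₋(π₊(α·cₙ(d))·dₙ) = π₋(α·π₋(d₁)⋯π₋(dₙ)). (The intertwining part of the Proposition 'Holonomies and dressing transformations', for a vertex with all edges incoming.) -/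
/-- The vertex holonomy `Holᵥ(d) = π₋(d₁)⋯π₋(dₙ)`. -/
def vertexHol {G : Type*} [Group G] (πm : G → G) {n : ℕ} (d : Fin n → G) : G :=
  ((List.finRange n).map (fun i => πm (d i))).prod

theorem Subgroup.IsComplement.eq_of_mul_mem {G : Type*} [Group G] {S T : Set G}
    (hc : Subgroup.IsComplement S T) {πm πp : G → G}
    (hπm : ∀ g, πm g ∈ S) (hπp : ∀ g, πp g ∈ T) (hfact : ∀ g, g = πm g * πp g)
    {x y : G} (hx : x ∈ S) (hy : y ∈ T) : πm (x * y) = x := by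
  have h := @hc.1 (⟨πm (x * y), hπm _⟩, ⟨πp (x * y), hπp _⟩) (⟨x, hx⟩, ⟨y, hy⟩)
    (hfact (x * y)).symm
  exact congrArg (fun p : S × T => (p.1 : G)) h

/-- The dressing cocycle identity for a factorization `G = G₋G₊`. -/
theorem Subgroup.IsComplement.proj_mul_proj {G : Type*} [Group G] {Gm Gp : Subgroup G}
    (hc : Subgroup.IsComplement (Gm : Set G) (Gp : Set G)) {πm πp : G → G}
    (hπm : ∀ g, πm g ∈ Gm) (hπp : ∀ g, πp g ∈ Gp) (hfact : ∀ g, g = πm g * πp g)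
    (a d : G) : πm a * πm (πp a * d) = πm (a * πm d) := by
  have hprod : a * πm d = πm a * πm (πp a * d) * (πp (πp a * d) * (πp d)⁻¹) := by
    calc a * πm d = πm a * πp a * (d * (πp d)⁻¹) := by
          rw [← hfact a, ← eq_mul_inv_of_mul_eq (hfact d).symm]
      _ = πm a * (πp a * d) * (πp d)⁻¹ := by group
      _ = πm a * (πm (πp a * d) * πp (πp a * d)) * (πp d)⁻¹ := by rw [← hfact (πp a * d)]
      _ = _ := by group
  rw [hprod]
  exact (hc.eq_of_mul_mem hπm hπp hfact (Gm.mul_mem (hπm _) (hπm _))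
    (Gp.mul_mem (hπp _) (Gp.inv_mem (hπp _)))).symm

theorem vertexHol_succ {G : Type*} [Group G] (πm : G → G) {n : ℕ} (d : Fin (n + 1) → G) :
    vertexHol πm d = vertexHol πm (fun i => d i.castSucc) * πm (d (Fin.last n)) := by
  simp [vertexHol, List.finRange_succ_last, Function.comp_def]

theorem vertexPartial_castSucc {G : Type*} [Group G] (πm : G → G) {n : ℕ}
    (d : Fin (n + 1) → G) (k : Fin n) :
    vertexPartial πm d k.castSucc = vertexPartial πm (fun i => d i.castSucc) k := by
  simp [vertexPartial, List.finRange_succ_last, List.filter_map, Function.comp_def,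
    (Fin.castSucc_lt_last k).not_gt, Fin.castSucc_lt_castSucc_iff]

theorem vertexPartial_last {G : Type*} [Group G] (πm : G → G) {n : ℕ}
    (d : Fin (n + 1) → G) :
    vertexPartial πm d (Fin.last n) = vertexHol πm (fun i => d i.castSucc) := by
  simp [vertexPartial, vertexHol, List.finRange_succ_last, List.filter_map, Function.comp_def,
    Fin.castSucc_lt_last]

/-- **The vertex holonomy intertwines the vertex action with the dressing action
of `G₊` on `G₋`:** for all `n ≥ 1`, `α ∈ G₊`, `d ∈ Gⁿ` one has
`Holᵥ(α ▷ᵥ d) = π₋(α·Holᵥ(d))`. -/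
theorem vertexHol_intertwines {G : Type*} [Group G] (Gm Gp : Subgroup G)
    (hc : Subgroup.IsComplement (Gm : Set G) (Gp : Set G))
    (πm πp : G → G)
    (hπm : ∀ g, πm g ∈ Gm) (hπp : ∀ g, πp g ∈ Gp)
    (hfact : ∀ g, g = πm g * πp g) :
    ∀ n : ℕ, 1 ≤ n → ∀ α : G, α ∈ Gp → ∀ d : Fin n → G,
      vertexHol πm (vertexAct πm πp α d) = πm (α * vertexHol πm d) := by
  intro n _ α hα
  clear * - hc hπm hπp hfact hα
  induction n with
  | zero =>
    intro d
    simpa [vertexHol] using (hc.eq_of_mul_mem hπm hπp hfact Gm.one_mem hα).symm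
  | succ n ih =>
    intro d
    have hact : (fun i : Fin n => vertexAct πm πp α d i.castSucc) =
        vertexAct πm πp α (fun i => d i.castSucc) := by
      funext i
      simp only [vertexAct, vertexPartial_castSucc]
    rw [vertexHol_succ, hact, ih, vertexHol_succ πm d, vertexAct, vertexPartial_last,
      hc.proj_mul_proj hπm hπp hfact, mul_assoc]
end

section
/- The vertex actions at the two endpoints of a bundle of n parallel edges commute: for all α, β ∈ G₊ and d ∈ Gⁿ one has α ▷ᵥ (β ▷ᵥ′ d) = β ▷ᵥ′ (α ▷ᵥ d); explicitly, both sides have k-th component π₊(α·cₖ(d))·dₖ·π₊(β·c′ₖ(d))⁻¹. (An instance of Proposition 3.22 (i): vertex actions for distinct vertices commute.) -/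
/-- The partial vertex holonomy `c′ₖ(d) = π₋(d₁⁻¹)⋯π₋(d_{k-1}⁻¹)` at the opposite
vertex, from which all edges are outgoing. -/
def outPartial {G : Type*} [Group G] (πm : G → G) {n : ℕ}
    (d : Fin n → G) (k : Fin n) : G :=
  (((List.finRange n).filter (fun i => decide (i < k))).map
    (fun i => πm ((d i)⁻¹))).prod

/-- The vertex action `(β ▷ᵥ′ d)ₖ = dₖ·π₊(β·c′ₖ(d))⁻¹` at the opposite vertex,
from which all edges are outgoing. -/
def outAct {G : Type*} [Group G] (πm πp : G → G) {n : ℕ}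
    (β : G) (d : Fin n → G) : Fin n → G :=
  fun k => d k * (πp (β * outPartial πm d k))⁻¹

/-- The `S`-component of a factorization along complementary subgroups `S`, `T` is invariant
under right multiplication by elements of `T`. -/
theorem Subgroup.IsComplement.left_factor_mul_right {G : Type*} [Group G] {S T : Subgroup G}
    (hc : Subgroup.IsComplement (S : Set G) (T : Set G)) {p q : G → G}
    (hp : ∀ g, p g ∈ S) (hq : ∀ g, q g ∈ T) (hfact : ∀ g, g = p g * q g)
    (g : G) {t : G} (ht : t ∈ T) : p (g * t) = p g := by
  have h : ((⟨p (g * t), hp _⟩, ⟨q (g * t), hq _⟩) : S × T) =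
      (⟨p g, hp _⟩, ⟨q g * t, T.mul_mem (hq _) ht⟩) := by
    apply hc.1
    change p (g * t) * q (g * t) = p g * (q g * t)
    rw [← hfact, ← mul_assoc, ← hfact]
  exact congrArg (fun x => (x.1 : G)) h

/-- **Vertex actions at the two endpoints of a bundle of `n` parallel edges
commute:** for all `α, β ∈ G₊` and `d ∈ Gⁿ` one has
`α ▷ᵥ (β ▷ᵥ′ d) = β ▷ᵥ′ (α ▷ᵥ d)`; explicitly, both sides have `k`-th component
`π₊(α·cₖ(d))·dₖ·π₊(β·c′ₖ(d))⁻¹`. -/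
theorem vertex_actions_commute {G : Type*} [Group G] (Gm Gp : Subgroup G)
    (hc : Subgroup.IsComplement (Gm : Set G) (Gp : Set G))
    (πm πp : G → G)
    (hπm : ∀ g, πm g ∈ Gm) (hπp : ∀ g, πp g ∈ Gp)
    (hfact : ∀ g, g = πm g * πp g) :
    ∀ n : ℕ, 1 ≤ n → ∀ α β : G, α ∈ Gp → β ∈ Gp → ∀ d : Fin n → G,
      vertexAct πm πp α (outAct πm πp β d) = outAct πm πp β (vertexAct πm πp α d) ∧
      ∀ k : Fin n,
        vertexAct πm πp α (outAct πm πp β d) k =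
          πp (α * vertexPartial πm d k) * d k * (πp (β * outPartial πm d k))⁻¹ := by
  intro n _ α β _ _ d
  have hinv : ∀ g t, t ∈ Gp → πm (g * t) = πm g := fun g _ ht =>
    hc.left_factor_mul_right hπm hπp hfact g ht
  have hin : ∀ k, vertexPartial πm (outAct πm πp β d) k = vertexPartial πm d k := by
    intro k
    simp only [vertexPartial, outAct, hinv _ _ (Gp.inv_mem (hπp _))]
  have hout : ∀ k, outPartial πm (vertexAct πm πp α d) k = outPartial πm d k := by
    intro k
    simp only [outPartial, vertexAct, mul_inv_rev, hinv _ _ (Gp.inv_mem (hπp _))]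
  have hleft : ∀ k, vertexAct πm πp α (outAct πm πp β d) k =
      πp (α * vertexPartial πm d k) * d k * (πp (β * outPartial πm d k))⁻¹ := by
    intro k
    rw [vertexAct, hin, outAct, mul_assoc]
  refine ⟨funext fun k => ?_, hleft⟩
  rw [hleft, outAct, hout, vertexAct]
end

section
/- The gluing map at a bivalent vertex is invariant under the vertex action at that vertex: for all α ∈ G₊ and d₁, d₂ ∈ G one has (d₂·π₊(α·π₋(d₁))⁻¹)·π₊(α·d₁) = d₂·π₊(d₁), i.e. ψ(α ▷ (d₁, d₂)) = ψ(d₁, d₂). (Lemma 3.11 (ii), vertex case, in the two-edge model.) -/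
/-- **The gluing map at a bivalent vertex is invariant under the vertex action
at that vertex:** for all `α ∈ G₊` and `d₁, d₂ ∈ G` one has
`(d₂·π₊(α·π₋(d₁))⁻¹)·π₊(α·d₁) = d₂·π₊(d₁)`, i.e. `ψ(α ▷ (d₁, d₂)) = ψ(d₁, d₂)`
for the vertex action `α ▷ (d₁, d₂) = (α·d₁, d₂·π₊(α·π₋(d₁))⁻¹)` and the gluing
map `ψ(d₁, d₂) = d₂·π₊(d₁)`. -/
theorem gluing_map_vertex_invariant {G : Type*} [Group G] (Gm Gp : Subgroup G)
    (hc : Subgroup.IsComplement (Gm : Set G) (Gp : Set G))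
    (πm πp : G → G)
    (hπm : ∀ g, πm g ∈ Gm) (hπp : ∀ g, πp g ∈ Gp)
    (hfact : ∀ g, g = πm g * πp g) :
    ∀ α : G, α ∈ Gp → ∀ d₁ d₂ : G,
      (d₂ * (πp (α * πm d₁))⁻¹) * πp (α * d₁) = d₂ * πp d₁ := by
  intro α _ d₁ d₂
  have hinj : ∀ x ∈ Gm, ∀ y ∈ Gp, ∀ x' ∈ Gm, ∀ y' ∈ Gp, x * y = x' * y' → y = y' := by
    intro x hx y hy x' hx' y' hy' h
    have heq := hc.1 (a₁ := (⟨x, hx⟩, ⟨y, hy⟩)) (a₂ := (⟨x', hx'⟩, ⟨y', hy'⟩)) h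
    exact congrArg (fun p => (p.2 : G)) heq
  have key : πp (α * d₁) = πp (α * πm d₁) * πp d₁ := by
    refine hinj _ (hπm (α * d₁)) _ (hπp _) _ (hπm (α * πm d₁)) _
      (Gp.mul_mem (hπp _) (hπp _)) ?_
    rw [← hfact, ← mul_assoc, ← hfact, mul_assoc, ← hfact]
  rw [key]
  group
end

section
/- The gluing map at a two-edge face is invariant under the face action at that face: for all x ∈ G₋ and d₁, d₂ ∈ G one has π₋(d₁·x⁻¹)·π₋(π₊(d₁)·x⁻¹)⁻¹·d₂ = π₋(d₁)·d₂ (equivalently π₋(d₁·x⁻¹) = π₋(d₁)·π₋(π₊(d₁)·x⁻¹)), i.e. ψ(x ▷ (d₁, d₂)) = ψ(d₁, d₂). (Lemma 3.11 (ii), face case, in the two-edge model.) -/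
/-- In a factorization `G = S · T`, the left factor of an element is unique. -/
theorem Subgroup.IsComplement.left_eq_of_mul_eq_mul {G : Type*} [Group G] {S T : Set G}
    (h : Subgroup.IsComplement S T) {a a' b b' : G} (ha : a ∈ S) (ha' : a' ∈ S)
    (hb : b ∈ T) (hb' : b' ∈ T) (hab : a * b = a' * b') : a = a' :=
  congrArg (fun p : S × T => (p.1 : G))
    (h.injective (a₁ := (⟨a, ha⟩, ⟨b, hb⟩)) (a₂ := (⟨a', ha'⟩, ⟨b', hb'⟩)) hab)

/-- **The gluing map at a two-edge face is invariant under the face action at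
that face:** for all `x ∈ G₋` and `d₁, d₂ ∈ G` one has
`π₋(d₁·x⁻¹)·π₋(π₊(d₁)·x⁻¹)⁻¹·d₂ = π₋(d₁)·d₂` (equivalently
`π₋(d₁·x⁻¹) = π₋(d₁)·π₋(π₊(d₁)·x⁻¹)`), i.e. `ψ(x ▷ (d₁, d₂)) = ψ(d₁, d₂)` for
the face action `x ▷ (d₁, d₂) = (d₁·x⁻¹, π₋(π₊(d₁)·x⁻¹)⁻¹·d₂)` and the gluing
map `ψ(d₁, d₂) = π₋(d₁)·d₂`. -/
theorem gluing_map_face_invariant {G : Type*} [Group G] (Gm Gp : Subgroup G)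
    (hc : Subgroup.IsComplement (Gm : Set G) (Gp : Set G))
    (πm πp : G → G)
    (hπm : ∀ g, πm g ∈ Gm) (hπp : ∀ g, πp g ∈ Gp)
    (hfact : ∀ g, g = πm g * πp g) :
    ∀ x : G, x ∈ Gm → ∀ d₁ d₂ : G,
      πm (d₁ * x⁻¹) * (πm (πp d₁ * x⁻¹))⁻¹ * d₂ = πm d₁ * d₂ ∧
      πm (d₁ * x⁻¹) = πm d₁ * πm (πp d₁ * x⁻¹) := by
  intro x _ d₁ d₂
  have key : πm (d₁ * x⁻¹) = πm d₁ * πm (πp d₁ * x⁻¹) := by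
    refine hc.left_eq_of_mul_eq_mul (hπm _) (Gm.mul_mem (hπm _) (hπm _))
      (hπp (d₁ * x⁻¹)) (hπp (πp d₁ * x⁻¹)) ?_
    rw [← hfact, mul_assoc, ← hfact, ← mul_assoc, ← hfact]
  exact ⟨by rw [key, mul_inv_cancel_right], key⟩
end

section
/- For all d₁, d₂ ∈ G the identity π₋(d₁)·d₂ = d₁·π₋(d₂⁻¹)⁻¹ holds if and only if π₊(d₂⁻¹)·π₊(d₁) = 1. (The face analogue of Equation (38) in the proof of Lemma 3.11 (iv): the holonomies along the two ends of an edge glued along a two-edge face agree exactly when the configuration is flat at that face.) -/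
/-- **Flatness at a two-edge face characterizes agreement of the two glued
holonomies:** for all `d₁, d₂ ∈ G` the identity `π₋(d₁)·d₂ = d₁·π₋(d₂⁻¹)⁻¹`
holds if and only if `π₊(d₂⁻¹)·π₊(d₁) = 1`. -/
theorem glued_holonomies_agree_iff_flat_face {G : Type*} [Group G]
    (Gm Gp : Subgroup G)
    (hc : Subgroup.IsComplement (Gm : Set G) (Gp : Set G))
    (πm πp : G → G)
    (hπm : ∀ g, πm g ∈ Gm) (hπp : ∀ g, πp g ∈ Gp)
    (hfact : ∀ g, g = πm g * πp g) :
    ∀ d₁ d₂ : G, πm d₁ * d₂ = d₁ * (πm d₂⁻¹)⁻¹ ↔ πp d₂⁻¹ * πp d₁ = 1 := by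
  intro d₁ d₂
  have h₁ : d₁ * (πm d₂⁻¹)⁻¹ = πm d₁ * (πp d₁ * (πm d₂⁻¹)⁻¹) := by
    rw [← mul_assoc, ← hfact]
  have h₂ : d₂ = (πp d₂⁻¹)⁻¹ * (πm d₂⁻¹)⁻¹ := by
    rw [← mul_inv_rev, ← hfact, inv_inv]
  calc πm d₁ * d₂ = d₁ * (πm d₂⁻¹)⁻¹
      ↔ d₂ = πp d₁ * (πm d₂⁻¹)⁻¹ := by rw [h₁, mul_right_inj]
    _ ↔ (πp d₂⁻¹)⁻¹ * (πm d₂⁻¹)⁻¹ = πp d₁ * (πm d₂⁻¹)⁻¹ := by rw [← h₂]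
    _ ↔ (πp d₂⁻¹)⁻¹ = πp d₁ := mul_left_inj _
    _ ↔ πp d₂⁻¹ * πp d₁ = 1 := by rw [mul_eq_one_iff_inv_eq]
end

section
/- On elements flat at the bivalent vertex, splitting after gluing equals a gauge transformation: if d₁, d₂ ∈ G satisfy π₋(d₁)·π₋(d₂⁻¹) = 1, then with α := π₊(d₂·π₋(d₁)⁻¹) ∈ G₊ one has α·d₁ = d₂·π₊(d₁) and d₂·π₊(α·π₋(d₁))⁻¹ = π₋(d₂·π₊(d₁)); that is, (φ ∘ ψ)(d₁, d₂) = α ▷ (d₁, d₂). (Equation (39) in the proof of Proposition 3.12 (iii).) -/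
/-- The projections of a factorization `G = G₋G₊` recover the factors of a product. -/
theorem factor_projections_mul {G : Type*} [Group G] {Gm Gp : Subgroup G}
    (hc : Subgroup.IsComplement (Gm : Set G) (Gp : Set G)) {πm πp : G → G}
    (hπm : ∀ g, πm g ∈ Gm) (hπp : ∀ g, πp g ∈ Gp) (hfact : ∀ g, g = πm g * πp g)
    {m p : G} (hm : m ∈ Gm) (hp : p ∈ Gp) : πm (m * p) = m ∧ πp (m * p) = p := by
  have h := @hc.1 (⟨πm (m * p), hπm _⟩, ⟨πp (m * p), hπp _⟩) (⟨m, hm⟩, ⟨p, hp⟩)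
    (hfact (m * p)).symm
  simpa using h

/-- **Splitting after gluing at a flat bivalent vertex is a gauge
transformation:** if `d₁, d₂ ∈ G` satisfy `π₋(d₁)·π₋(d₂⁻¹) = 1`, then with
`α := π₊(d₂·π₋(d₁)⁻¹) ∈ G₊` one has `α·d₁ = d₂·π₊(d₁)` and
`d₂·π₊(α·π₋(d₁))⁻¹ = π₋(d₂·π₊(d₁))`; that is, `(φ ∘ ψ)(d₁, d₂) = α ▷ (d₁, d₂)`
for the gluing map `ψ(d₁, d₂) = d₂·π₊(d₁)`, the splitting map `φ(g) = (g, π₋(g))`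
and the vertex action `α ▷ (d₁, d₂) = (α·d₁, d₂·π₊(α·π₋(d₁))⁻¹)`. -/
theorem split_after_glue_vertex {G : Type*} [Group G] (Gm Gp : Subgroup G)
    (hc : Subgroup.IsComplement (Gm : Set G) (Gp : Set G))
    (πm πp : G → G)
    (hπm : ∀ g, πm g ∈ Gm) (hπp : ∀ g, πp g ∈ Gp)
    (hfact : ∀ g, g = πm g * πp g) :
    ∀ d₁ d₂ : G, πm d₁ * πm d₂⁻¹ = 1 →
      let α := πp (d₂ * (πm d₁)⁻¹)
      α ∈ Gp ∧ α * d₁ = d₂ * πp d₁ ∧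
        d₂ * (πp (α * πm d₁))⁻¹ = πm (d₂ * πp d₁) := by
  intro d₁ d₂ hflat α
  have proj : ∀ {m p : G}, m ∈ Gm → p ∈ Gp → πm (m * p) = m ∧ πp (m * p) = p :=
    factor_projections_mul hc hπm hπp hfact
  have hinv : πm d₂⁻¹ = (πm d₁)⁻¹ := eq_inv_of_mul_eq_one_right hflat
  have hd₂ : d₂ * (πm d₁)⁻¹ = (πp d₂⁻¹)⁻¹ := by
    have h := hfact d₂⁻¹
    rw [hinv] at h
    rw [eq_inv_iff_mul_eq_one, mul_assoc, ← h, mul_inv_cancel]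
  have hα : α = d₂ * (πm d₁)⁻¹ := by
    have h := (proj Gm.one_mem (Gp.inv_mem (hπp d₂⁻¹))).2
    rwa [one_mul, ← hd₂] at h
  refine ⟨hπp _, ?_, ?_⟩
  · rw [hα, mul_assoc, inv_mul_eq_of_eq_mul (hfact d₁)]
  · rw [hα, inv_mul_cancel_right, mul_inv_eq_of_eq_mul (hfact d₂)]
    have h := (proj (hπm d₂) (Gp.mul_mem (hπp d₂) (hπp d₁))).1
    rw [← mul_assoc, ← hfact d₂] at h
    exact h.symm
end

section
/- Vertex actions for cyclically permuted orderings are related by a gauge element on flat configurations: let ▷ᵥ′ be the vertex action for the cyclically permuted ordering (2, 3, …, n, 1), i.e. (α ▷ᵥ′ d)ₖ = π₊(α·c′ₖ(d))·dₖ where c′ₖ(d) := π₋(d₂)⋯π₋(d_{k−1}) for 2 ≤ k ≤ n (so c′₂(d) = 1) and c′₁(d) := π₋(d₂)⋯π₋(dₙ). If Holᵥ(d) = 1 then α ▷ᵥ′ d = π₊(α·π₋(d₁)⁻¹) ▷ᵥ d for all α ∈ G₊. (Lemma 3.10 (i), in the case of a vertex all of whose incident edges are incoming.) -/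
/-- The partial vertex holonomy for the cyclically permuted ordering
`(2, 3, …, n, 1)`: `c′ₖ(d) = π₋(d₂)⋯π₋(d_{k-1})` for `2 ≤ k ≤ n` (so
`c′₂(d) = 1`), and `c′₁(d) = π₋(d₂)⋯π₋(dₙ)`. -/
def cycVertexPartial {G : Type*} [Group G] (πm : G → G) {n : ℕ}
    (d : Fin n → G) (k : Fin n) : G :=
  if (k : ℕ) = 0 then
    (((List.finRange n).filter (fun i : Fin n => decide (1 ≤ (i : ℕ)))).map
      (fun i => πm (d i))).prod
  else
    (((List.finRange n).filter (fun i : Fin n => decide (1 ≤ (i : ℕ) ∧ i < k))).map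
      (fun i => πm (d i))).prod

/-- The vertex action for the cyclically permuted ordering `(2, 3, …, n, 1)`:
`(α ▷ᵥ′ d)ₖ = π₊(α·c′ₖ(d))·dₖ`. -/
def cycVertexAct {G : Type*} [Group G] (πm πp : G → G) {n : ℕ}
    (α : G) (d : Fin n → G) : Fin n → G :=
  fun k => πp (α * cycVertexPartial πm d k) * d k

theorem vertexHol_eq_mul_cycVertexPartial_zero {G : Type*} [Group G] (πm : G → G) {n : ℕ}
    (d : Fin (n + 1) → G) :
    vertexHol πm d = πm (d 0) * cycVertexPartial πm d 0 := by
  simp [vertexHol, cycVertexPartial, List.finRange_succ, List.filter_map, Function.comp_def]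

theorem vertexPartial_zero {G : Type*} [Group G] (πm : G → G) {n : ℕ}
    (d : Fin (n + 1) → G) : vertexPartial πm d 0 = 1 := by
  simp [vertexPartial]

theorem vertexPartial_succ_eq_mul_cycVertexPartial {G : Type*} [Group G] (πm : G → G) {n : ℕ}
    (d : Fin (n + 1) → G) (k : Fin n) :
    vertexPartial πm d k.succ = πm (d 0) * cycVertexPartial πm d k.succ := by
  simp [vertexPartial, cycVertexPartial, List.finRange_succ, List.filter_map, Function.comp_def]

/-- The `G₊`-component of a product only depends on the `G₊`-component of the left factor. -/
theorem projRight_projRight_mul {G : Type*} [Group G] {Gm Gp : Subgroup G}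
    (hc : Subgroup.IsComplement (Gm : Set G) (Gp : Set G)) {πm πp : G → G}
    (hπm : ∀ g, πm g ∈ Gm) (hπp : ∀ g, πp g ∈ Gp) (hfact : ∀ g, g = πm g * πp g) (g h : G) :
    πp (πp g * h) = πp (g * h) := by
  have key : πm g * πm (πp g * h) * πp (πp g * h) = πm (g * h) * πp (g * h) := by
    rw [← hfact, mul_assoc, ← hfact, ← mul_assoc, ← hfact]
  have inj := @hc.1 (⟨πm g * πm (πp g * h), Gm.mul_mem (hπm _) (hπm _)⟩, ⟨_, hπp _⟩)
    (⟨_, hπm _⟩, ⟨_, hπp _⟩) key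
  exact congrArg (fun x => (x.2 : G)) inj

/-- **Vertex actions for cyclically permuted orderings are related by a gauge
element on flat configurations:** if `Holᵥ(d) = 1`, then
`α ▷ᵥ′ d = π₊(α·π₋(d₁)⁻¹) ▷ᵥ d` for all `α ∈ G₊`. -/
theorem cyclic_vertex_action_flat {G : Type*} [Group G] (Gm Gp : Subgroup G)
    (hc : Subgroup.IsComplement (Gm : Set G) (Gp : Set G))
    (πm πp : G → G)
    (hπm : ∀ g, πm g ∈ Gm) (hπp : ∀ g, πp g ∈ Gp)
    (hfact : ∀ g, g = πm g * πp g) :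
    ∀ (n : ℕ) (hn : 0 < n) (d : Fin n → G), vertexHol πm d = 1 →
      ∀ α : G, α ∈ Gp →
        cycVertexAct πm πp α d =
          vertexAct πm πp (πp (α * (πm (d ⟨0, hn⟩))⁻¹)) d := by
  intro n hn d hflat α _
  obtain ⟨n, rfl⟩ := Nat.exists_eq_succ_of_ne_zero hn.ne'
  funext k
  change πp (α * cycVertexPartial πm d k) * d k =
    πp (πp (α * (πm (d 0))⁻¹) * vertexPartial πm d k) * d k
  rw [projRight_projRight_mul hc hπm hπp hfact, mul_assoc]
  congr 3
  rw [eq_inv_mul_iff_mul_eq]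
  cases k using Fin.cases with
  | zero => rw [← vertexHol_eq_mul_cycVertexPartial_zero, hflat, vertexPartial_zero]
  | succ k => rw [vertexPartial_succ_eq_mul_cycVertexPartial]
end

section
/- Face actions for cyclically permuted orderings are related by a gauge element on flat configurations: let ▷_f′ be the face action for the cyclically permuted ordering (2, 3, …, n, 1), i.e. (x ▷_f′ d)ₖ = dₖ·π₋(h′ₖ(d)·x⁻¹) where h′ₖ(d) := π₊(d_{k−1})⋯π₊(d₂) for 2 ≤ k ≤ n (so h′₂(d) = 1) and h′₁(d) := π₊(dₙ)⋯π₊(d₂). If Hol_f(d) = 1 then x ▷_f′ d = π₋((x·π₊(d₁))⁻¹)⁻¹ ▷_f d for all x ∈ G₋. (Lemma 3.10 (ii), in the case of a face all of whose adjacent edges are oriented clockwise.) -/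
/-- The partial face holonomy `hₖ(d) = π₊(d_{k-1})⋯π₊(d₁)` (ordered product, in
decreasing order of indices, over the indices strictly below `k`). -/
def facePartial {G : Type*} [Group G] (πp : G → G) {n : ℕ}
    (d : Fin n → G) (k : Fin n) : G :=
  ((((List.finRange n).filter (fun i => decide (i < k))).reverse).map
    (fun i => πp (d i))).prod

/-- The face action `(x ▷_f d)ₖ = dₖ·π₋(hₖ(d)·x⁻¹)` of `G₋` on `Gⁿ`. -/
def faceAct {G : Type*} [Group G] (πm πp : G → G) {n : ℕ}
    (x : G) (d : Fin n → G) : Fin n → G :=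
  fun k => d k * πm (facePartial πp d k * x⁻¹)

/-- The face holonomy `Hol_f(d) = π₊(dₙ)⋯π₊(d₁)`. -/
def faceHol {G : Type*} [Group G] (πp : G → G) {n : ℕ} (d : Fin n → G) : G :=
  (((List.finRange n).reverse).map (fun i => πp (d i))).prod

/-- The partial face holonomy for the cyclically permuted ordering
`(2, 3, …, n, 1)`: `h′ₖ(d) = π₊(d_{k-1})⋯π₊(d₂)` for `2 ≤ k ≤ n` (so
`h′₂(d) = 1`), and `h′₁(d) = π₊(dₙ)⋯π₊(d₂)`. -/
def cycFacePartial {G : Type*} [Group G] (πp : G → G) {n : ℕ}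
    (d : Fin n → G) (k : Fin n) : G :=
  if (k : ℕ) = 0 then
    ((((List.finRange n).filter (fun i : Fin n => decide (1 ≤ (i : ℕ)))).reverse).map
      (fun i => πp (d i))).prod
  else
    ((((List.finRange n).filter
        (fun i : Fin n => decide (1 ≤ (i : ℕ) ∧ i < k))).reverse).map
      (fun i => πp (d i))).prod

/-- The face action for the cyclically permuted ordering `(2, 3, …, n, 1)`:
`(x ▷_f′ d)ₖ = dₖ·π₋(h′ₖ(d)·x⁻¹)`. -/
def cycFaceAct {G : Type*} [Group G] (πm πp : G → G) {n : ℕ}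
    (x : G) (d : Fin n → G) : Fin n → G :=
  fun k => d k * πm (cycFacePartial πp d k * x⁻¹)

/-- The `Gm`-factor of a product does not change under right multiplication by `Gp`. -/
theorem minusFactor_mul_right {G : Type*} [Group G] {Gm Gp : Subgroup G}
    (hc : Subgroup.IsComplement (Gm : Set G) (Gp : Set G)) {πm πp : G → G}
    (hπm : ∀ g, πm g ∈ Gm) (hπp : ∀ g, πp g ∈ Gp) (hfact : ∀ g, g = πm g * πp g)
    (g : G) {u : G} (hu : u ∈ Gp) : πm (g * u) = πm g := by
  have h := @hc.1 (⟨πm (g * u), hπm _⟩, ⟨πp (g * u), hπp _⟩)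
    (⟨πm g, hπm g⟩, ⟨πp g * u, Gp.mul_mem (hπp g) hu⟩)
    (by simp only [← hfact, ← mul_assoc])
  exact congrArg (fun p => (p.1 : G)) h

/-- On flat configurations the two partial holonomies differ by the holonomy of the first edge. -/
theorem facePartial_eq_cycFacePartial_mul {G : Type*} [Group G] (πp : G → G) {n : ℕ}
    (hn : 0 < n) (d : Fin n → G) (hd : faceHol πp d = 1) (k : Fin n) :
    facePartial πp d k = cycFacePartial πp d k * πp (d ⟨0, hn⟩) := by
  obtain ⟨m, rfl⟩ : ∃ m, n = m + 1 := ⟨n - 1, by omega⟩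
  induction k using Fin.cases with
  | zero =>
    simpa [facePartial, cycFacePartial, faceHol, List.finRange_succ, List.filter_map,
      Function.comp_def] using hd.symm
  | succ j =>
    simp [facePartial, cycFacePartial, List.finRange_succ, List.filter_map, Function.comp_def]

/-- **Face actions for cyclically permuted orderings are related by a gauge
element on flat configurations:** if `Hol_f(d) = 1`, then
`x ▷_f′ d = π₋((x·π₊(d₁))⁻¹)⁻¹ ▷_f d` for all `x ∈ G₋`. -/
theorem cyclic_face_action_flat {G : Type*} [Group G] (Gm Gp : Subgroup G)
    (hc : Subgroup.IsComplement (Gm : Set G) (Gp : Set G))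
    (πm πp : G → G)
    (hπm : ∀ g, πm g ∈ Gm) (hπp : ∀ g, πp g ∈ Gp)
    (hfact : ∀ g, g = πm g * πp g) :
    ∀ (n : ℕ) (hn : 0 < n) (d : Fin n → G), faceHol πp d = 1 →
      ∀ x : G, x ∈ Gm →
        cycFaceAct πm πp x d =
          faceAct πm πp ((πm ((x * πp (d ⟨0, hn⟩))⁻¹))⁻¹) d := by
  intro n hn d hd x _
  funext k
  have hu : (πp ((x * πp (d ⟨0, hn⟩))⁻¹))⁻¹ ∈ Gp := Gp.inv_mem (hπp _)
  have hy : πm ((x * πp (d ⟨0, hn⟩))⁻¹) =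
      (x * πp (d ⟨0, hn⟩))⁻¹ * (πp ((x * πp (d ⟨0, hn⟩))⁻¹))⁻¹ :=
    eq_mul_inv_of_mul_eq (hfact _).symm
  have hk : facePartial πp d k * πm ((x * πp (d ⟨0, hn⟩))⁻¹) =
      cycFacePartial πp d k * x⁻¹ * (πp ((x * πp (d ⟨0, hn⟩))⁻¹))⁻¹ := by
    rw [hy, facePartial_eq_cycFacePartial_mul πp hn d hd k]
    group
  simp only [cycFaceAct, faceAct, inv_inv]
  rw [hk, minusFactor_mul_right hc hπm hπp hfact _ hu]
end

section
/- The face actions for the two faces on either side of a bundle of n parallel edges commute: for all x, y ∈ G₋ and d ∈ Gⁿ one has x ▷_f (y ▷_f′ d) = y ▷_f′ (x ▷_f d); explicitly, both sides have k-th component π₋(h′ₖ(d)·y⁻¹)⁻¹·dₖ·π₋(hₖ(d)·x⁻¹). (An instance of Proposition 3.22 (i): face actions for distinct faces commute.) -/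
/-- The partial face holonomy `h′ₖ(d) = π₊(d_{k-1}⁻¹)⋯π₊(d₁⁻¹)` for the face to
the left of the `n` parallel edges. -/
def leftFacePartial {G : Type*} [Group G] (πp : G → G) {n : ℕ}
    (d : Fin n → G) (k : Fin n) : G :=
  ((((List.finRange n).filter (fun i => decide (i < k))).reverse).map
    (fun i => πp ((d i)⁻¹))).prod

/-- The face action `(y ▷_f′ d)ₖ = π₋(h′ₖ(d)·y⁻¹)⁻¹·dₖ` for the face to the left
of the edges. -/
def leftFaceAct {G : Type*} [Group G] (πm πp : G → G) {n : ℕ}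
    (y : G) (d : Fin n → G) : Fin n → G :=
  fun k => (πm (leftFacePartial πp d k * y⁻¹))⁻¹ * d k

/-- The projection to the right factor of a complement pair is invariant under left
multiplication by elements of the left factor. -/
theorem proj_mul_left_eq {G : Type*} [Group G] {Gm Gp : Subgroup G}
    (hc : Subgroup.IsComplement (Gm : Set G) (Gp : Set G)) {πm πp : G → G}
    (hπm : ∀ g, πm g ∈ Gm) (hπp : ∀ g, πp g ∈ Gp) (hfact : ∀ g, g = πm g * πp g)
    {m : G} (hm : m ∈ Gm) (g : G) : πp (m * g) = πp g := by
  have h := @hc.1 (⟨πm (m * g), hπm _⟩, ⟨πp (m * g), hπp _⟩)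
    (⟨m * πm g, Gm.mul_mem hm (hπm g)⟩, ⟨πp g, hπp g⟩)
    (by simp only [mul_assoc, ← hfact])
  exact congrArg (fun p => (p.2 : G)) h

/-- **The face actions for the two faces on either side of a bundle of `n`
parallel edges commute:** for all `x, y ∈ G₋` and `d ∈ Gⁿ` one has
`x ▷_f (y ▷_f′ d) = y ▷_f′ (x ▷_f d)`; explicitly, both sides have `k`-th
component `π₋(h′ₖ(d)·y⁻¹)⁻¹·dₖ·π₋(hₖ(d)·x⁻¹)`. -/
theorem face_actions_commute {G : Type*} [Group G] (Gm Gp : Subgroup G)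
    (hc : Subgroup.IsComplement (Gm : Set G) (Gp : Set G))
    (πm πp : G → G)
    (hπm : ∀ g, πm g ∈ Gm) (hπp : ∀ g, πp g ∈ Gp)
    (hfact : ∀ g, g = πm g * πp g) :
    ∀ n : ℕ, 1 ≤ n → ∀ x y : G, x ∈ Gm → y ∈ Gm → ∀ d : Fin n → G,
      faceAct πm πp x (leftFaceAct πm πp y d) =
        leftFaceAct πm πp y (faceAct πm πp x d) ∧
      ∀ k : Fin n,
        faceAct πm πp x (leftFaceAct πm πp y d) k =
          (πm (leftFacePartial πp d k * y⁻¹))⁻¹ * d k *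
            πm (facePartial πp d k * x⁻¹) := by
  intro n _ x y _ _ d
  have hinv {m : G} (hm : m ∈ Gm) (g : G) : πp (m * g) = πp g :=
    proj_mul_left_eq hc hπm hπp hfact hm g
  have hright (k : Fin n) :
      facePartial πp (leftFaceAct πm πp y d) k = facePartial πp d k := by
    simp only [facePartial, leftFaceAct, hinv (Gm.inv_mem (hπm _))]
  have hleft (k : Fin n) :
      leftFacePartial πp (faceAct πm πp x d) k = leftFacePartial πp d k := by
    simp only [leftFacePartial, faceAct, mul_inv_rev, hinv (Gm.inv_mem (hπm _))]
  have hcomp (k : Fin n) :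
      faceAct πm πp x (leftFaceAct πm πp y d) k =
        (πm (leftFacePartial πp d k * y⁻¹))⁻¹ * d k * πm (facePartial πp d k * x⁻¹) := by
    rw [faceAct, hright, leftFaceAct]
  refine ⟨funext fun k => ?_, hcomp⟩
  rw [hcomp, leftFaceAct, hleft, faceAct, mul_assoc]
end
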